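/- Let ω(x) = p + q·1_{(a,b)}(x) with 0 < a < b and p, q ≥ 0. Suppose W^{(p)}, W^{(p+q)} vanish on negatives and satisfy W^{(p+q)} − W^{(p)} = q W^{(p+q)} ∗ W^{(p)} (half-line convolution). Define 𝒲_a^{(p,q)}(x) = W^{(p)}(x) + q ∫_a^x W^{(p+q)}(x−y) W^{(p)}(y) dy. Then the unique locally bounded solution 𝒲^{(ω)} of 𝒲^{(ω)}(x) = W^{(p)}(x) + q ∫₀ˣ W^{(p)}(x−z) 1_{[a,b]}(z) 𝒲^{(ω)}(z) dz satisfies 𝒲^{(ω)}(x) = 𝒲_a^{(p,q)}(x) for all x ∈ [0,b]. -/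

import Mathlib

open Set MeasureTheory intervalIntegral

def LocallyBdd (f : ℝ → ℝ) : Prop :=
  ∀ K : Set ℝ, IsCompact K → ∃ M : ℝ, ∀ x ∈ K, |f x| ≤ M

/-- A real function is a.e. measurable on the union of all open sets on which it is
a.e. measurable. -/
theorem aemeasurable_restrict_sUnion_isOpen (f : ℝ → ℝ) :
    AEMeasurable f (volume.restrict
      (⋃₀ {V : Set ℝ | IsOpen V ∧ AEMeasurable f (volume.restrict V)})) := by
  obtain ⟨T, hTc, hTS, hT⟩ := TopologicalSpace.isOpen_sUnion_countable
    {V : Set ℝ | IsOpen V ∧ AEMeasurable f (volume.restrict V)} (fun V hV => hV.1)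
  rw [← hT, sUnion_eq_iUnion]
  have : Countable T := hTc
  exact aemeasurable_iUnion_iff.2 fun V => (hTS V.2).2

/-- If the Bochner integral takes its default value `0` whenever the integrand fails to be
integrable, a solution of a renewal equation with continuous kernel is
still a.e. measurable. -/
theorem aemeasurable_of_renewal_equation {a b q : ℝ} (ha : 0 < a) {k w φ : ℝ → ℝ}
    (hk : Continuous k) (hkneg : ∀ x < (0 : ℝ), k x = 0) (hφ : Measurable φ)
    (heq : ∀ x ≥ (0 : ℝ), w x = φ x + q * ∫ z in (0 : ℝ)..x, k (x - z) * (Icc a b).indicator w z) :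
    AEMeasurable w (volume.restrict (Icc a b)) := by
  set f : ℝ → ℝ := (Icc a b).indicator w with hf
  set U : Set ℝ := ⋃₀ {V : Set ℝ | IsOpen V ∧ AEMeasurable f (volume.restrict V)} with hU
  have hUo : IsOpen U := isOpen_sUnion fun V hV => hV.1
  have hfU : AEMeasurable (U.indicator f) :=
    (aemeasurable_indicator_iff hUo.measurableSet).2 (aemeasurable_restrict_sUnion_isOpen f)
  have hk0 : ∀ x ≤ (0 : ℝ), k x = 0 := by
    have h : EqOn k 0 (closure (Iio 0)) :=
      EqOn.closure (fun x hx => hkneg x hx) hk continuous_const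
    rw [closure_Iio] at h
    exact fun x hx => h hx
  have hUa : Iio a ⊆ U := by
    refine subset_sUnion_of_mem ⟨isOpen_Iio, ?_⟩
    refine (aemeasurable_const (b := (0 : ℝ))).congr ?_
    filter_upwards [ae_restrict_mem measurableSet_Iio] with x hx
    exact (indicator_of_notMem (fun h => absurd h.1 (not_le.2 hx)) _).symm
  set C : Set ℝ := {x | ∀ z, k (x - z) ≠ 0 → z ∈ U} with hC
  have hCc : IsClosed C := by
    have : C = ⋂ z ∈ Uᶜ, {x | k (x - z) = 0} := by
      ext x
      simp only [hC, mem_ofPred_eq, mem_iInter, mem_compl_iff]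
      exact forall_congr' fun z => not_imp_comm
    rw [this]
    exact isClosed_biInter fun z _ =>
      isClosed_eq (hk.comp (continuous_id.sub continuous_const)) continuous_const
  set g : ℝ → ℝ := hfU.mk _ with hg
  have hgm : Measurable g := hfU.measurable_mk
  set G : ℝ → ℝ := fun x => ∫ z in Ioi (0 : ℝ), k (x - z) * g z with hG
  have hGm : Measurable G := by
    refine (StronglyMeasurable.integral_prod_right'
      (f := fun p : ℝ × ℝ => k (p.1 - p.2) * g p.2) ?_).measurable
    exact Measurable.stronglyMeasurable
      ((hk.measurable.comp (measurable_fst.sub measurable_snd)).mul (hgm.comp measurable_snd))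
  have hint : ∀ x ≥ (0 : ℝ), ∫ z in (0 : ℝ)..x, k (x - z) * f z = C.indicator G x := by
    intro x hx
    by_cases hxC : x ∈ C
    · rw [indicator_of_mem hxC, integral_of_le hx]
      have h1 : ∀ z, k (x - z) * f z = k (x - z) * U.indicator f z := by
        intro z
        by_cases hz : k (x - z) = 0
        · simp [hz]
        · rw [indicator_of_mem (hxC z hz)]
      simp_rw [h1]
      rw [hG]
      dsimp only
      rw [setIntegral_eq_of_subset_of_forall_sdiff_eq_zero measurableSet_Ioi
        (Ioc_subset_Ioi_self : Ioc 0 x ⊆ Ioi 0)]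
      · refine integral_congr_ae (ae_restrict_of_ae ?_)
        filter_upwards [hfU.ae_eq_mk] with z hz
        rw [hz]
      · rintro z ⟨hz0, hz⟩
        have : x < z := by
          by_contra h
          exact hz ⟨hz0, not_lt.1 h⟩
        rw [hkneg _ (by linarith), zero_mul]
    · rw [indicator_of_notMem hxC, integral_of_le hx]
      refine integral_undef fun hi => hxC fun z hz => ?_
      by_contra hzU
      have hza : a ≤ z := not_lt.1 fun h => hzU (hUa h)
      have hzx : z < x := by
        by_contra h
        exact hz (hk0 _ (by linarith))
      refine hzU (mem_sUnion_of_mem (t := {y | k (x - y) ≠ 0} ∩ Ioo 0 x)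
        ⟨hz, ha.trans_le hza, hzx⟩ ⟨?_, ?_⟩)
      · exact (isOpen_ne_fun (hk.comp (continuous_const.sub continuous_id))
          continuous_const).inter isOpen_Ioo
      · have hVm : MeasurableSet ({y | k (x - y) ≠ 0} ∩ Ioo 0 x) :=
          ((isOpen_ne_fun (hk.comp (continuous_const.sub continuous_id))
            continuous_const).inter isOpen_Ioo).measurableSet
        have hm : AEMeasurable (fun y => k (x - y) * f y)
            (volume.restrict ({y | k (x - y) ≠ 0} ∩ Ioo 0 x)) :=
          hi.aestronglyMeasurable.aemeasurable.mono_measure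
            (Measure.restrict_mono (inter_subset_right.trans Ioo_subset_Ioc_self) le_rfl)
        have hkm : Measurable fun y => k (x - y) :=
          hk.measurable.comp (measurable_const.sub measurable_id)
        refine (hkm.inv.aemeasurable.mul hm).congr ?_
        filter_upwards [ae_restrict_mem hVm] with y hy
        have : k (x - y) ≠ 0 := hy.1
        simp [this]
  refine AEMeasurable.congr (f := fun x => φ x + q * C.indicator G x) ?_ ?_
  · exact (hφ.add ((hGm.indicator hCc.measurableSet).const_mul q)).aemeasurable
  · filter_upwards [ae_restrict_mem measurableSet_Icc] with x hx
    rw [heq x (ha.le.trans hx.1), hint x (ha.le.trans hx.1)]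

/-- If `w = k + q k ∗ w` on `[a, x]` and `l` is the resolvent of `k`, then
`k ∗ w = l ∗ k` at `x`, where all convolutions are over `[a, x]`. -/
theorem convolution_eq_of_resolvent {a x q : ℝ} {k l w : ℝ → ℝ}
    (hk : Continuous k) (hl : Continuous l)
    (hkneg : ∀ x < (0 : ℝ), k x = 0)
    (hres : ∀ x ≥ (0 : ℝ), l x - k x = q * ∫ y in (0 : ℝ)..x, l (x - y) * k y)
    (hw : IntegrableOn w (Icc a x))
    (heq : ∀ y ∈ Icc a x, w y = k y + q * ∫ z in Icc a x, k (y - z) * w z) :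
    ∫ z in Icc a x, k (x - z) * w z = ∫ y in Icc a x, l (x - y) * k y := by
  have hmul : ∀ {h : ℝ → ℝ}, Continuous h → IntegrableOn (fun z => h (x - z) * w z) (Icc a x) :=
    fun hh => hw.continuousOn_mul (hh.comp (continuous_const.sub continuous_id)).continuousOn
      isCompact_Icc
  have hlk : IntegrableOn (fun y => l (x - y) * k y) (Icc a x) :=
    ((hl.comp (continuous_const.sub continuous_id)).mul hk).continuousOn.integrableOn_compact
      isCompact_Icc
  have hprod : Integrable (Function.uncurry fun y z => l (x - y) * (k (y - z) * w z))
      ((volume.restrict (Icc a x)).prod (volume.restrict (Icc a x))) := by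
    have h1 : Integrable (fun p : ℝ × ℝ => w p.2)
        ((volume.restrict (Icc a x)).prod (volume.restrict (Icc a x))) :=
      Integrable.comp_snd hw _
    rw [Measure.prod_restrict] at h1 ⊢
    have hc : Continuous fun p : ℝ × ℝ => l (x - p.1) * k (p.1 - p.2) := by fun_prop
    refine (IntegrableOn.continuousOn_mul hc.continuousOn h1
      (isCompact_Icc.prod isCompact_Icc)).congr (Filter.Eventually.of_forall fun p => ?_)
    simp only [Function.uncurry]
    ring
  have hinner : ∀ z ∈ Icc a x,
      q * ∫ y in Icc a x, l (x - y) * (k (y - z) * w z) = l (x - z) * w z - k (x - z) * w z := by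
    intro z hz
    rw [← sub_mul, hres (x - z) (sub_nonneg.2 hz.2), mul_assoc, ← intervalIntegral.integral_mul_const]
    congr 1
    rw [setIntegral_eq_of_subset_of_forall_sdiff_eq_zero measurableSet_Icc
      (Icc_subset_Icc_left hz.1), integral_Icc_eq_integral_Ioc, ← integral_of_le hz.2]
    · have := intervalIntegral.integral_comp_sub_right (a := z) (b := x)
        (fun u => l (x - z - u) * k u * w z) z
      rw [sub_self] at this
      rw [← this]
      refine intervalIntegral.integral_congr fun y _ => ?_
      simp only [sub_sub_sub_cancel_right, mul_assoc]
    · rintro y ⟨hy, hyz⟩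
      have : y < z := by
        by_contra h
        exact hyz ⟨not_lt.1 h, hy.2⟩
      rw [hkneg _ (by linarith)]
      simp
  have hswap : q * ∫ y in Icc a x, l (x - y) * ∫ z in Icc a x, k (y - z) * w z =
      (∫ z in Icc a x, l (x - z) * w z) - ∫ z in Icc a x, k (x - z) * w z := by
    simp_rw [← MeasureTheory.integral_const_mul (l _)]
    rw [integral_integral_swap hprod, ← integral_sub (hmul hl) (hmul hk),
      ← MeasureTheory.integral_const_mul]
    exact setIntegral_congr_fun measurableSet_Icc hinner
  have hI : Integrable (fun y => l (x - y) * ∫ z in Icc a x, k (y - z) * w z)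
      (volume.restrict (Icc a x)) := by
    refine hprod.integral_prod_left.congr (Filter.Eventually.of_forall fun y => ?_)
    simp only [Function.uncurry]
    exact MeasureTheory.integral_const_mul _ _
  have hlw : ∫ y in Icc a x, l (x - y) * w y = (∫ y in Icc a x, l (x - y) * k y) +
      q * ∫ y in Icc a x, l (x - y) * ∫ z in Icc a x, k (y - z) * w z := by
    rw [← MeasureTheory.integral_const_mul, ← integral_add hlk (hI.const_mul q)]
    refine setIntegral_congr_fun measurableSet_Icc fun y hy => ?_
    rw [heq y hy]
    ring
  linarith

theorem occupation_scale_on_interval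
    (a b p q : ℝ) (ha : 0 < a) (hab : a < b) (hp : 0 ≤ p) (hq : 0 ≤ q)
    (Wp Wpq 𝒲 : ℝ → ℝ)
    (hWpcont : Continuous Wp) (hWpqcont : Continuous Wpq)
    (hWpneg : ∀ x < (0:ℝ), Wp x = 0) (hWpqneg : ∀ x < (0:ℝ), Wpq x = 0)
    (hres : ∀ x ≥ (0:ℝ),
      Wpq x - Wp x = q * ∫ y in (0:ℝ)..x, Wpq (x - y) * Wp y)
    (h𝒲 : LocallyBdd 𝒲)
    (heq : ∀ x ≥ (0:ℝ), 𝒲 x = Wp x +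
      q * ∫ z in (0:ℝ)..x, Wp (x - z) * Set.indicator (Set.Icc a b) (fun _ => (1:ℝ)) z * 𝒲 z) :
    ∀ x ∈ Set.Icc (0:ℝ) b,
      𝒲 x = Wp x + q * ∫ y in a..x, Wpq (x - y) * Wp y := by

  intro x hx
  simp_rw [mul_assoc (Wp _), ← indicator_mul_left, one_mul] at heq
  change ∀ x ≥ (0 : ℝ), 𝒲 x = Wp x + q * ∫ z in (0 : ℝ)..x, Wp (x - z) * (Icc a b).indicator 𝒲 z
    at heq
  have hm := aemeasurable_of_renewal_equation ha hWpcont hWpneg hWpcont.measurable heq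
  obtain ⟨M, hM⟩ := h𝒲 (Icc a b) isCompact_Icc
  have hint : IntegrableOn 𝒲 (Icc a b) :=
    Integrable.of_bound hm.aestronglyMeasurable M
      (ae_restrict_of_forall_mem measurableSet_Icc hM)
  rcases lt_or_ge x a with hxa | hxa
  · have h1 : ∫ z in (0 : ℝ)..x, Wp (x - z) * (Icc a b).indicator 𝒲 z = 0 := by
      refine (intervalIntegral.integral_congr (g := fun _ => (0 : ℝ)) fun z hz => ?_).trans (by simp)
      rw [uIcc_of_le hx.1] at hz
      have : z ∉ Icc a b := fun h => by linarith [h.1, hz.2]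
      simp [indicator_of_notMem this]
    have h2 : ∫ y in a..x, Wpq (x - y) * Wp y = 0 := by
      rw [integral_symm, integral_of_le hxa.le, setIntegral_eq_zero_of_forall_eq_zero, neg_zero]
      intro y hy
      rw [hWpqneg _ (by linarith [hy.1]), zero_mul]
    rw [heq x hx.1, h1, h2]
  · have hconv : ∀ y ∈ Icc a x, ∫ z in (0 : ℝ)..y, Wp (y - z) * (Icc a b).indicator 𝒲 z =
        ∫ z in Icc a x, Wp (y - z) * 𝒲 z := by
      intro y hy
      rw [integral_of_le (ha.le.trans hy.1)]
      have h1 : ∀ z, (Ioc 0 y).indicator (fun z => Wp (y - z) * (Icc a b).indicator 𝒲 z) z =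
          (Icc a x).indicator (fun z => Wp (y - z) * 𝒲 z) z := by
        intro z
        by_cases hz : z ∈ Icc a y
        · rw [indicator_of_mem (show z ∈ Ioc 0 y from ⟨ha.trans_le hz.1, hz.2⟩),
            indicator_of_mem (show z ∈ Icc a b from ⟨hz.1, hz.2.trans (hy.2.trans hx.2)⟩),
            indicator_of_mem (show z ∈ Icc a x from ⟨hz.1, hz.2.trans hy.2⟩)]
        · rcases lt_or_ge z a with hza | hza
          · have h2 : ∀ c, z ∉ Icc a c := fun c h => absurd h.1 (not_le.2 hza)
            rw [indicator_of_notMem (h2 x), indicator_apply, indicator_of_notMem (h2 b)]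
            simp
          · have hzy : y < z := by
              by_contra h
              exact hz ⟨hza, not_lt.1 h⟩
            simp [indicator_apply, hWpneg (y - z) (by linarith)]
      rw [← MeasureTheory.integral_indicator measurableSet_Ioc,
        ← MeasureTheory.integral_indicator measurableSet_Icc]
      exact congrArg _ (funext h1)
    rw [heq x hx.1, hconv x (right_mem_Icc.2 hxa),
      convolution_eq_of_resolvent hWpcont hWpqcont hWpneg hres
        (hint.mono_set (Icc_subset_Icc_right hx.2))
        (fun y hy => by rw [← hconv y hy]; exact heq y (ha.le.trans hy.1)),
      integral_of_le hxa, integral_Icc_eq_integral_Ioc]
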